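/- Under the closed-loop safe-following dynamics, for all t ≥ 0 one has v₂(t)² ≤ v₂(0)² − v₁(0)² + V̄²; that is, the follower's speed is uniformly bounded even though no speed limit is imposed on it. -/

import Mathlib

/-- Safe-following distance. -/
noncomputable def Dsafe (um L v₁ v₂ : ℝ) : ℝ :=
  L + max 0 ((v₂ ^ 2 - v₁ ^ 2) / (-2 * um))

/-- Unsaturated safe-following control (for `v₂ > 0`, `σ ≠ 0`). -/
noncomputable def gus (um v₁ v₂ σ u : ℝ) : ℝ :=
  (v₁ / v₂ * (1 + σ * u / (-um)) - 1) * (-um / σ)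

/-- Safety ratio. -/
noncomputable def ratio (um L : ℝ) (x₁ x₂ v₁ v₂ : ℝ → ℝ) (t : ℝ) : ℝ :=
  (x₁ t - x₂ t) / Dsafe um L (v₁ t) (v₂ t)

/-- A function that starts nonnegative and has positive derivative wherever it is negative
stays nonnegative. -/
theorem nonneg_of_deriv_pos_of_neg {f f' : ℝ → ℝ} {a b : ℝ} (hab : a ≤ b) (ha : 0 ≤ f a)
    (hf : ∀ t ∈ Set.Icc a b, HasDerivAt f (f' t) t)
    (hpos : ∀ t ∈ Set.Icc a b, f t < 0 → 0 < f' t) : 0 ≤ f b := by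
  have key : ∀ ε : ℝ, 0 < ε → -f b ≤ 0 + ε := by
    intro ε hε
    rw [zero_add]
    refine image_le_of_deriv_right_lt_deriv_boundary (f := fun t => -f t) (f' := fun t => -f' t)
      (B := fun _ => ε) (B' := fun _ => 0) (a := a) (b := b) ?_ ?_ ?_ ?_ ?_ ⟨hab, le_rfl⟩
    · exact fun t ht => (hf t ht).continuousAt.continuousWithinAt.neg
    · exact fun t ht => (hf t ⟨ht.1, ht.2.le⟩).neg.hasDerivWithinAt
    · linarith
    · exact fun t => hasDerivAt_const t ε
    · intro t ht hB
      have hneg : f t < 0 := by linarith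
      have := hpos t ⟨ht.1, ht.2.le⟩ hneg
      linarith
  linarith [le_of_forall_pos_le_add key]

theorem Dsafe_pos {um L : ℝ} (hL : 0 < L) (v₁ v₂ : ℝ) : 0 < Dsafe um L v₁ v₂ :=
  add_pos_of_pos_of_nonneg hL (le_max_left _ _)

theorem Dsafe_of_sq_le {um L v₁ v₂ : ℝ} (hum : um < 0) (h : 0 ≤ v₂ ^ 2 - v₁ ^ 2) :
    Dsafe um L v₁ v₂ = L + (v₂ ^ 2 - v₁ ^ 2) / (-2 * um) := by
  rw [Dsafe, max_eq_right (div_nonneg h (by linarith))]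

/-- Under the safe-following control, the derivative of `v₂ ^ 2 - v₁ ^ 2` does not depend on the
leader's acceleration. -/
theorem hasDerivAt_sq_sub_sq_of_gus {um σ u t : ℝ} {v₁ v₂ : ℝ → ℝ} (hum : um < 0) (hσ : σ ≠ 0)
    (hpos : 0 < v₂ t) (hv₁ : HasDerivAt v₁ u t)
    (hv₂ : HasDerivAt v₂ (gus um (v₁ t) (v₂ t) σ u) t) :
    HasDerivAt (fun s => v₂ s ^ 2 - v₁ s ^ 2) (-2 * um * (v₁ t - v₂ t) / σ) t := by
  refine ((hv₂.pow 2).sub (hv₁.pow 2)).congr_deriv ?_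
  have := hum.ne
  have := hpos.ne'
  unfold gus
  field_simp
  ring

/-- under the closed-loop safe-following dynamics, the follower's speed is uniformly bounded: v₂(t)² ≤ v₂(0)² − v₁(0)² + V̄². -/
theorem closed_loop_speed_bound
    (um uM L σ₀ V : ℝ) (hum : um < 0) (huM : 0 < uM) (hL : 0 < L)
    (hσ₀ : 1 < σ₀) (hV : 0 ≤ V)
    (x₁ x₂ v₁ v₂ u₁ : ℝ → ℝ)
    (hx₁ : ∀ t : ℝ, 0 ≤ t → HasDerivAt x₁ (v₁ t) t)
    (hx₂ : ∀ t : ℝ, 0 ≤ t → HasDerivAt x₂ (v₂ t) t)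
    (hv₁ : ∀ t : ℝ, 0 ≤ t → HasDerivAt v₁ (u₁ t) t)
    (hu₁ : ∀ t : ℝ, 0 ≤ t → u₁ t ∈ Set.Icc um uM)
    (hv₁bnd : ∀ t : ℝ, 0 ≤ t → v₁ t ∈ Set.Icc 0 V)
    (hv₂pos : ∀ t : ℝ, 0 ≤ t → 0 < v₂ t)
    (hv₂ : ∀ t : ℝ, 0 ≤ t →
      HasDerivAt v₂ (gus um (v₁ t) (v₂ t) (ratio um L x₁ x₂ v₁ v₂ t) (u₁ t)) t)
    (hinit : v₁ 0 ≤ v₂ 0)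
    (hσinit : ratio um L x₁ x₂ v₁ v₂ 0 ∈ Set.Icc 1 σ₀) :
    ∀ t : ℝ, 0 ≤ t → (v₂ t) ^ 2 ≤ (v₂ 0) ^ 2 - (v₁ 0) ^ 2 + V ^ 2 := by
  set h : ℝ → ℝ := fun t => x₁ t - x₂ t with hh
  set w : ℝ → ℝ := fun t => v₂ t ^ 2 - v₁ t ^ 2 with hw
  set σ : ℝ → ℝ := ratio um L x₁ x₂ v₁ v₂ with hσ
  have hσh : ∀ t, 0 < h t → 0 < σ t := fun t ht => div_pos ht (Dsafe_pos hL _ _)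
  have hh' : ∀ t, 0 ≤ t → HasDerivAt h (v₁ t - v₂ t) t := fun t ht => (hx₁ t ht).sub (hx₂ t ht)
  have hw' : ∀ t, 0 ≤ t → 0 < h t → HasDerivAt w (-2 * um * (v₁ t - v₂ t) / σ t) t :=
    fun t ht hp => hasDerivAt_sq_sub_sq_of_gus hum (hσh t hp).ne' (hv₂pos t ht) (hv₁ t ht) (hv₂ t ht)
  have hw0 : 0 ≤ w 0 := by
    have := (hv₁bnd 0 le_rfl).1
    simp only [hw]
    nlinarith
  have hwnn : ∀ T, 0 ≤ T → (∀ t ∈ Set.Icc 0 T, 0 < h t) → 0 ≤ w T := by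
    intro T hT hpos
    refine nonneg_of_deriv_pos_of_neg hT hw0 (fun t ht => hw' t ht.1 (hpos t ht)) ?_
    intro t ht hneg
    refine div_pos (mul_pos (by linarith) ?_) (hσh t (hpos t ht))
    have h1 := (hv₁bnd t ht.1).1
    have h2 := hv₂pos t ht.1
    simp only [hw] at hneg
    nlinarith
  have hLh : ∀ T, 0 ≤ T → (∀ t ∈ Set.Icc 0 T, 0 < h t) → L ≤ h T := by
    intro T hT hpos
    have hnn : ∀ t ∈ Set.Icc 0 T, 0 ≤ w t := fun t ht =>
      hwnn t ht.1 fun s hs => hpos s ⟨hs.1, hs.2.trans ht.2⟩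
    have hD : ∀ t ∈ Set.Icc 0 T, Dsafe um L (v₁ t) (v₂ t) = L + w t / (-2 * um) :=
      fun t ht => Dsafe_of_sq_le hum (hnn t ht)
    have hDpos : ∀ t ∈ Set.Icc 0 T, 0 < L + w t / (-2 * um) :=
      fun t ht => hD t ht ▸ Dsafe_pos hL _ _
    have hσq : ∀ t ∈ Set.Icc 0 T, σ t = h t / (L + w t / (-2 * um)) := by
      intro t ht
      rw [← hD t ht]
      rfl
    have hq' : ∀ t ∈ Set.Icc 0 T, HasDerivAt (fun s => h s / (L + w s / (-2 * um))) 0 t := by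
      intro t ht
      have hht := hpos t ht
      have hDt := hDpos t ht
      refine ((hh' t ht.1).div (((hw' t ht.1 hht).div_const (-2 * um)).const_add L)
        hDt.ne').congr_deriv ?_
      rw [hσq t ht]
      have := hum.ne
      generalize L + w t / (-2 * um) = D at hDt ⊢
      field_simp
      ring
    have hconst := constant_of_has_deriv_right_zero
      (fun t ht => (hq' t ht).continuousAt.continuousWithinAt)
      (fun t ht => (hq' t ⟨ht.1, ht.2.le⟩).hasDerivWithinAt) T ⟨hT, le_rfl⟩
    have h1 : 1 ≤ h T / (L + w T / (-2 * um)) := by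
      rw [hconst, ← hσq 0 ⟨le_rfl, hT⟩]
      exact hσinit.1
    rw [one_le_div (hDpos T ⟨hT, le_rfl⟩)] at h1
    have : 0 ≤ w T / (-2 * um) := div_nonneg (hnn T ⟨hT, le_rfl⟩) (by linarith)
    linarith
  have hh0 : 0 < h 0 := by
    have h1 : 1 ≤ h 0 / Dsafe um L (v₁ 0) (v₂ 0) := hσinit.1
    rw [one_le_div (Dsafe_pos hL _ _)] at h1
    exact (Dsafe_pos hL _ _).trans_le h1
  have hhpos : ∀ t, 0 ≤ t → 0 < h t := by
    by_contra! hcon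
    obtain ⟨b, hb, hhb⟩ := hcon
    have hcont : ContinuousOn h (Set.Icc 0 b) :=
      fun t ht => (hh' t ht.1).continuousAt.continuousWithinAt
    obtain ⟨T, ⟨hTmem, hT⟩, hleast⟩ := (isCompact_Icc.of_isClosed_subset
      (hcont.preimage_isClosed_of_isClosed isClosed_Icc isClosed_Iic)
      Set.inter_subset_left).exists_isLeast (⟨b, ⟨hb, le_rfl⟩, hhb⟩ :
        (Set.Icc 0 b ∩ h ⁻¹' Set.Iic 0).Nonempty)
    have hbefore : ∀ t ∈ Set.Ico 0 T, 0 < h t := by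
      intro t ht
      by_contra! hle
      exact ht.2.not_ge (hleast ⟨⟨ht.1, ht.2.le.trans hTmem.2⟩, hle⟩)
    have hT0 : 0 < T := hTmem.1.lt_of_ne fun h0 => (h0 ▸ hT : h 0 ≤ 0).not_gt hh0
    have hlim : Filter.Tendsto h (nhdsWithin T (Set.Iio T)) (nhds (h T)) :=
      (hh' T hTmem.1).continuousAt.tendsto.mono_left nhdsWithin_le_nhds
    have hLT : L ≤ h T := by
      refine ge_of_tendsto hlim ?_
      filter_upwards [Ioo_mem_nhdsLT hT0] with t ht
      exact hLh t ht.1.le fun s hs => hbefore s ⟨hs.1, hs.2.trans_lt ht.2⟩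
    exact (hL.trans_le hLT).not_ge hT
  intro t ht
  have hanti : AntitoneOn w (Set.Ici 0) := by
    refine antitoneOn_of_hasDerivWithinAt_nonpos (convex_Ici 0)
      (fun s hs => (hw' s hs (hhpos s hs)).continuousAt.continuousWithinAt)
      (fun s hs => (hw' s (interior_subset hs) (hhpos s (interior_subset hs))).hasDerivWithinAt) ?_
    intro s hs
    have hs0 : 0 ≤ s := interior_subset hs
    have hws := hwnn s hs0 fun r hr => hhpos r hr.1
    have h2 : v₁ s ≤ v₂ s :=
      (abs_le_of_sq_le_sq' (sub_nonneg.mp hws) (hv₂pos s hs0).le).2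
    exact div_nonpos_of_nonpos_of_nonneg
      (mul_nonpos_of_nonneg_of_nonpos (by linarith) (by linarith)) (hσh s (hhpos s hs0)).le
  have hle := hanti (Set.mem_Ici.mpr le_rfl) (Set.mem_Ici.mpr ht) ht
  simp only [hw] at hle
  have hv := hv₁bnd t ht
  have := pow_le_pow_left₀ hv.1 hv.2 2
  linarith
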